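/- Let E be a real normed space, let x, y ∈ E, and let r > 0, δ > 0, c ≥ 1 and p, q ∈ [0,1] be real numbers. Suppose ‖x‖ = ‖y‖ = r, ‖x − y‖ ≥ δ/(2c), δ ≤ 2c·r, and max{p, q} ≥ 1/2. Then ‖p·x − q·y‖ ≥ δ/(12c). -/

import Mathlib

/-- Let `x, y` be vectors of a real normed space with `‖x‖ = ‖y‖ = r > 0`, let
`δ > 0`, `c ≥ 1` and `p, q ∈ [0,1]`.  If `‖x - y‖ ≥ δ/(2c)`, `δ ≤ 2cr` and
`max{p,q} ≥ 1/2`, then `‖p•x - q•y‖ ≥ δ/(12c)`. -/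
theorem norm_smul_sub_smul_lower_bound {E : Type*} [NormedAddCommGroup E]
    [NormedSpace ℝ E] (x y : E) (r δ c p q : ℝ)
    (hr : 0 < r) (hδ : 0 < δ) (hc : 1 ≤ c)
    (hp : p ∈ Set.Icc (0 : ℝ) 1) (hq : q ∈ Set.Icc (0 : ℝ) 1)
    (hx : ‖x‖ = r) (hy : ‖y‖ = r)
    (hxy : δ / (2 * c) ≤ ‖x - y‖) (hδr : δ ≤ 2 * c * r)
    (hmax : 1 / 2 ≤ max p q) :
    δ / (12 * c) ≤ ‖p • x - q • y‖ := by
  have hN : |p - q| * r ≤ ‖p • x - q • y‖ := by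
    have h := abs_norm_sub_norm_le (p • x) (q • y)
    rw [norm_smul, norm_smul, hx, hy, Real.norm_of_nonneg hp.1, Real.norm_of_nonneg hq.1,
      ← sub_mul, abs_mul, abs_of_pos hr] at h
    exact h
  have h1 : p * ‖x - y‖ ≤ ‖p • x - q • y‖ + |p - q| * r := by
    have e : p • (x - y) = (p • x - q • y) - (p - q) • y := by module
    have h := norm_sub_le (p • x - q • y) ((p - q) • y)
    rw [← e, norm_smul, norm_smul, hy, Real.norm_of_nonneg hp.1, Real.norm_eq_abs] at h
    exact h
  have h2 : q * ‖x - y‖ ≤ ‖p • x - q • y‖ + |p - q| * r := by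
    have e : q • (x - y) = (p • x - q • y) - (p - q) • x := by module
    have h := norm_sub_le (p • x - q • y) ((p - q) • x)
    rw [← e, norm_smul, norm_smul, hx, Real.norm_of_nonneg hq.1, Real.norm_eq_abs] at h
    exact h
  have hn := norm_nonneg (x - y)
  have h0 : 0 < δ / (2 * c) := by positivity
  have e : δ / (12 * c) = δ / (2 * c) / 6 := by
    field_simp
    norm_num
  rw [e]
  rcases le_max_iff.mp hmax with h | h
  · have := mul_le_mul_of_nonneg_right h hn
    linarith
  · have := mul_le_mul_of_nonneg_right h hn
    linarith
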